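/- In the Singer model of PG(2,q) with v = q²+q+1, d a divisor of v, t = v/d, point orbits O_0,…,O_{t−1} of the subgroup generated by σ^t, and ℓ_0 any fixed line of PG(2,q) with w_u = |ℓ_0 ∩ O_u|, one has Σ_{i=0}^{t−1} w_i = q+1 and Σ_{i=0}^{t−1} w_i² = (q² + (t+1)q + 1)/t. -/

import Mathlib

/-- If the `D.card * (D.card - 1)` ordered pairs of distinct elements of `D` suffice to represent
every nonzero group element as a difference, then each is represented exactly once, and counting
pairs in a common fibre of a homomorphism `φ` gives the sum of squares of the fibre sizes. -/
theorem sum_sq_card_fiber_of_differences {G K : Type*} [AddCommGroup G] [Fintype G]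
    [DecidableEq G] [AddCommGroup K] [Fintype K] [DecidableEq K] (φ : G →+ K) (D : Finset G)
    (hcard : D.card * D.card = D.card + (Fintype.card G - 1))
    (hdiff : ∀ k : G, k ≠ 0 → ∃ m ∈ D, ∃ n ∈ D, m - n = k) :
    ∑ u : K, (D.filter (fun n => φ n = u)).card ^ 2 + 1
      = D.card + (Finset.univ.filter (fun g : G => φ g = 0)).card := by
  have hoff : D.offDiag.card = (Finset.univ.erase (0 : G)).card := by
    rw [Finset.offDiag_card, Finset.card_erase_of_mem (Finset.mem_univ _), Finset.card_univ]
    omega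
  have hmaps : Set.MapsTo (fun x : G × G => x.1 - x.2) D.offDiag (Finset.univ.erase (0 : G)) := by
    intro x hx
    have hx' := Finset.mem_offDiag.mp (Finset.mem_coe.mp hx)
    simpa [sub_eq_zero] using hx'.2.2
  have hsurj : Set.SurjOn (fun x : G × G => x.1 - x.2) D.offDiag (Finset.univ.erase (0 : G)) := by
    intro k hk
    have hk0 : k ≠ 0 := by simpa using hk
    obtain ⟨m, hm, n, hn, rfl⟩ := hdiff k hk0
    refine ⟨(m, n), ?_, rfl⟩
    exact Finset.mem_coe.mpr (Finset.mem_offDiag.mpr ⟨hm, hn, fun h => hk0 (sub_eq_zero.mpr h)⟩)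
  have hinj := Finset.injOn_of_surjOn_of_card_le _ hmaps hsurj hoff.le
  have hker : (D.offDiag.filter (fun x => φ x.1 = φ x.2)).card
      = ((Finset.univ.filter (fun g : G => φ g = 0)).erase 0).card := by
    refine Finset.card_nbij (fun x : G × G => x.1 - x.2) ?_ ?_ ?_
    · intro x hx
      simp only [Finset.coe_filter, Set.mem_ofPred_eq, Finset.mem_offDiag] at hx
      simp [sub_eq_zero, hx.1.2.2, hx.2]
    · exact hinj.mono (Finset.coe_subset.mpr (Finset.filter_subset _ _))
    · intro k hk
      have hk' : k ≠ 0 ∧ φ k = 0 := by simpa [and_comm] using hk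
      obtain ⟨x, hx, rfl⟩ := hsurj (show k ∈ _ by simpa using hk'.1)
      exact ⟨x, by simpa [sub_eq_zero] using ⟨by simpa using hx, by simpa [sub_eq_zero] using hk'.2⟩,
        rfl⟩
  have hdiag : (D.diag.filter (fun x => φ x.1 = φ x.2)).card = D.card := by
    rw [Finset.filter_true_of_mem, Finset.diag_card]
    intro x hx
    rw [(Finset.mem_diag.mp hx).2]
  have hsum : ∑ u : K, (D.filter (fun n => φ n = u)).card ^ 2
      = ((D ×ˢ D).filter (fun x => φ x.1 = φ x.2)).card := by
    rw [Finset.card_eq_sum_card_fiberwise (f := fun x : G × G => φ x.1) (t := Finset.univ)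
      (fun _ _ => Finset.mem_coe.mpr (Finset.mem_univ _))]
    refine Finset.sum_congr rfl fun u _ => ?_
    rw [sq, ← Finset.card_product]
    congr 1
    ext x
    simp only [Finset.mem_product, Finset.mem_filter]
    grind
  have hzero : 0 < (Finset.univ.filter (fun g : G => φ g = 0)).card :=
    Finset.card_pos.mpr ⟨0, by simp⟩
  rw [hsum, ← Finset.diag_union_offDiag, Finset.filter_union, Finset.card_union_of_disjoint
    (Finset.disjoint_filter_filter (Finset.disjoint_diag_offDiag D)), hdiag, hker,
    Finset.card_erase_of_mem (by simp)]
  omega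

/-- The elements of a subfield with `q` elements are exactly the roots of `X ^ q - X`. -/
theorem Subfield.mem_of_pow_eq_self {F : Type*} [Field F] [Finite F] (K : Subfield F) {q : ℕ}
    (hq : 1 < q) (hK : Nat.card K = q) {x : F} (hx : x ^ q = x) : x ∈ K := by
  classical
  have := Fintype.ofFinite F
  have hne : (Polynomial.X ^ q - Polynomial.X : Polynomial F) ≠ 0 :=
    FiniteField.X_pow_card_sub_X_ne_zero F hq
  have hmem (y : F) : y ∈ (Polynomial.X ^ q - Polynomial.X : Polynomial F).roots.toFinset ↔
      y ^ q = y := by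
    simp [Polynomial.mem_roots hne, sub_eq_zero]
  have hsub : Finset.univ.filter (· ∈ K) ⊆
      (Polynomial.X ^ q - Polynomial.X : Polynomial F).roots.toFinset := by
    intro y hy
    rw [hmem]
    have hyK : y ∈ K := by simpa using hy
    have h := FiniteField.pow_card (⟨y, hyK⟩ : K)
    rw [← Nat.card_eq_fintype_card, hK] at h
    simpa using congrArg Subtype.val h
  have hcard : (Polynomial.X ^ q - Polynomial.X : Polynomial F).roots.toFinset.card ≤
      (Finset.univ.filter (· ∈ K)).card := by
    calc _ ≤ _ := Multiset.toFinset_card_le _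
      _ ≤ _ := Polynomial.card_roots' _
      _ = q := FiniteField.X_pow_card_sub_X_natDegree_eq F hq
      _ = _ := by rw [← hK, Nat.card_eq_fintype_card, Fintype.card_subtype]
  have := (Finset.eq_of_subset_of_card_le hsub hcard).ge ((hmem x).mpr hx)
  simpa using this

/-- A primitive element of a finite field has order the number of nonzero elements. -/
theorem orderOf_of_forall_exists_pow {F : Type*} [Field F] [Finite F] {α : F} (hα : α ≠ 0)
    (hprim : ∀ x : F, x ≠ 0 → ∃ i : ℕ, α ^ i = x) : orderOf α = Nat.card F - 1 := by
  have h : orderOf (Units.mk0 α hα) = Nat.card Fˣ := by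
    refine orderOf_eq_card_of_forall_mem_zpowers fun x => ?_
    obtain ⟨i, hi⟩ := hprim x x.ne_zero
    exact ⟨i, by ext; simpa using hi⟩
  rw [← orderOf_units, Units.val_mk0] at h
  rw [h, Nat.card_units]

theorem pow_mem_subfield_iff {F : Type*} [Field F] [Finite F] (K : Subfield F) {q : ℕ}
    (hq : 1 < q) (hK : Nat.card K = q) {α : F} (hα : α ≠ 0) {v : ℕ}
    (hord : orderOf α = v * (q - 1)) (i : ℕ) : α ^ i ∈ K ↔ v ∣ i := by
  have hiff : v ∣ i ↔ (α ^ i) ^ (q - 1) = 1 := by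
    rw [← pow_mul, ← orderOf_dvd_iff_pow_eq_one, hord,
      Nat.mul_dvd_mul_iff_right (Nat.sub_pos_of_lt hq)]
  rw [hiff]
  constructor
  · intro h
    have := Fintype.ofFinite K
    have h1 := FiniteField.pow_card_sub_one_eq_one (⟨α ^ i, h⟩ : K)
      (by simpa [Subtype.ext_iff] using fun h0 => absurd h0 hα)
    rw [← Nat.card_eq_fintype_card, hK] at h1
    simpa using congrArg Subtype.val h1
  · intro h
    refine K.mem_of_pow_eq_self hq hK ?_
    conv_lhs => rw [← Nat.sub_add_cancel hq.le, pow_succ, h, one_mul]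

theorem Nat.count_mul_of_periodic (P : ℕ → Prop) [DecidablePred P] {v : ℕ}
    (hP : ∀ i, P (v + i) ↔ P i) (k : ℕ) : Nat.count P (v * k) = k * Nat.count P v := by
  induction k with
  | zero => simp
  | succ k ih =>
    rw [Nat.mul_succ, Nat.add_comm, Nat.count_add]
    simp only [hP]
    rw [ih]
    ring

theorem span_pow_eq_span_pow_iff {F : Type*} [Field F] [Finite F] (K : Subfield F) {q : ℕ}
    (hq : 1 < q) (hK : Nat.card K = q) {α : F} (hα : α ≠ 0) {v : ℕ}
    (hord : orderOf α = v * (q - 1)) (i j : ℕ) :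
    Submodule.span K {α ^ i} = Submodule.span K {α ^ j} ↔ i ≡ j [MOD v] := by
  wlog hij : i ≤ j generalizing i j
  · rw [eq_comm, this j i (by omega)]
    exact ⟨Nat.ModEq.symm, Nat.ModEq.symm⟩
  rw [Nat.modEq_iff_dvd' hij, ← pow_mem_subfield_iff K hq hK hα hord]
  have hj : α ^ j = α ^ (j - i) * α ^ i := by rw [← pow_add, Nat.sub_add_cancel hij]
  constructor
  · intro h
    have hmem : α ^ j ∈ Submodule.span K {α ^ i} := h ▸ Submodule.mem_span_singleton_self _
    obtain ⟨c, hc⟩ := Submodule.mem_span_singleton.mp hmem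
    rw [hj] at hc
    have : (c : F) = α ^ (j - i) := mul_right_cancel₀ (pow_ne_zero i hα) hc
    exact this ▸ c.2
  · intro h
    have hu : IsUnit (⟨α ^ (j - i), h⟩ : K) :=
      isUnit_iff_ne_zero.mpr (by simpa [Subtype.ext_iff] using fun h0 => absurd h0 hα)
    rw [hj]
    exact (Submodule.span_singleton_smul_eq hu (α ^ i)).symm

theorem pow_mem_submodule_periodic {F : Type*} [Field F] (K : Subfield F) {α : F} (hα : α ≠ 0)
    {v : ℕ} (hv : α ^ v ∈ K) (L : Submodule K F) (i : ℕ) : α ^ (v + i) ∈ L ↔ α ^ i ∈ L := by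
  rw [pow_add]
  exact L.smul_mem_iff (s := (⟨α ^ v, hv⟩ : K))
    (by simpa [Subtype.ext_iff] using fun h0 => absurd h0 hα)

/-- The powers `α ^ i`, `i < orderOf α`, lying in `L` are the nonzero elements of `L`. -/
theorem count_pow_mem {F : Type*} [Field F] [Finite F] (K : Subfield F) {α : F} (hα : α ≠ 0)
    (hprim : ∀ x : F, x ≠ 0 → ∃ i : ℕ, α ^ i = x) (L : Submodule K F)
    [DecidablePred fun i => α ^ i ∈ L] :
    Nat.count (fun i => α ^ i ∈ L) (orderOf α) + 1 = Nat.card L := by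
  classical
  have := Fintype.ofFinite F
  have hcard : Nat.card L = (Finset.univ.filter (· ∈ L)).card := by
    rw [Nat.card_eq_fintype_card, Fintype.card_subtype]
  have hpos : 0 < (Finset.univ.filter (· ∈ L)).card := Finset.card_pos.mpr ⟨0, by simp⟩
  have hL : (Finset.univ.filter (· ∈ L)).card - 1 =
      ((Finset.univ.filter (· ∈ L)).erase 0).card :=
    (Finset.card_erase_of_mem (by simp)).symm
  rw [hcard, Nat.count_eq_card_filter_range, ← Nat.sub_add_cancel hpos, Nat.succ_eq_add_one,
    zero_add, hL]
  congr 1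
  refine Finset.card_nbij (α ^ ·) ?_ ?_ ?_
  · intro i hi
    simp only [Finset.coe_filter, Set.mem_ofPred_eq] at hi
    simp [hi.2, hα]
  · intro i hi j hj h
    simp only [Finset.coe_filter, Finset.mem_range, Set.mem_ofPred_eq] at hi hj
    exact pow_injOn_Iio_orderOf hi.1 hj.1 h
  · intro x hx
    have hx' : x ≠ 0 ∧ x ∈ L := by simpa [and_comm] using hx
    obtain ⟨i, rfl⟩ := hprim x hx'.1
    refine ⟨i % orderOf α, ?_, pow_mod_orderOf α i⟩
    simp only [Finset.coe_filter, Finset.mem_range, Set.mem_ofPred_eq, pow_mod_orderOf]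
    exact ⟨Nat.mod_lt _ (orderOf_pos_iff.mpr (isOfFinOrder_iff_pow_eq_one.mpr
      ⟨Nat.card F - 1, Nat.sub_pos_of_lt Finite.one_lt_card, by
        rw [Nat.card_eq_fintype_card]; exact FiniteField.pow_card_sub_one_eq_one α hα⟩)), hx'.2⟩

/-- Two subspaces `L` and `β⁻¹ L` meet nontrivially once `L` has more than `√|F|` elements. -/
theorem exists_ne_zero_mem_mul_mem {F : Type*} [Field F] [Finite F] (K : Subfield F)
    (L : Submodule K F) (h : Nat.card F < Nat.card L * Nat.card L) (β : F) :
    ∃ x : F, x ≠ 0 ∧ x ∈ L ∧ β * x ∈ L := by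
  rw [← Nat.card_prod] at h
  obtain ⟨⟨x, y⟩, ⟨x', y'⟩, hne, heq⟩ : ∃ a b : L × L, a ≠ b ∧
      β * (a.1 : F) - a.2 = β * (b.1 : F) - b.2 := by
    by_contra! hcon
    exact absurd (Nat.card_le_card_of_injective (fun a : L × L => β * (a.1 : F) - a.2)
      fun a b hab => by_contra fun hab' => hcon a b hab' hab) (by omega)
  have hmul : β * ((x : F) - x') = (y : F) - y' := by
    simp only at heq
    linear_combination heq
  refine ⟨(x : F) - x', fun h0 => hne ?_, L.sub_mem x.2 x'.2, hmul ▸ L.sub_mem y.2 y'.2⟩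
  rw [h0, mul_zero] at hmul
  exact Prod.ext (Subtype.ext (sub_eq_zero.mp h0)) (Subtype.ext (sub_eq_zero.mp hmul.symm))

theorem ZMod.sum_range_natCast {M : Type*} [AddCommMonoid M] (t : ℕ) [NeZero t]
    (f : ZMod t → M) : ∑ i ∈ Finset.range t, f i = ∑ u : ZMod t, f u := by
  refine Finset.sum_nbij (fun i => (i : ZMod t)) (by simp) ?_ ?_ (fun _ _ => rfl)
  · intro i hi j hj h
    have hij := (ZMod.natCast_eq_natCast_iff' i j t).mp h
    simp only [Finset.coe_range, Set.mem_Iio] at hi hj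
    rwa [Nat.mod_eq_of_lt hi, Nat.mod_eq_of_lt hj] at hij
  · intro u _
    exact ⟨u.val, by simpa using ZMod.val_lt u, ZMod.natCast_zmod_val u⟩

theorem ZMod.card_filter_castHom_eq_zero {d t v : ℕ} [NeZero v] [NeZero t] (hv : v = d * t) :
    (Finset.univ.filter
      (fun g : ZMod v => ZMod.castHom (Dvd.intro_left d hv.symm) (ZMod t) g = 0)).card = d := by
  have hlag := AddSubgroup.card_mul_index
    (ZMod.castHom (Dvd.intro_left d hv.symm) (ZMod t)).toAddMonoidHom.ker
  rw [AddSubgroup.index_ker, AddMonoidHom.range_eq_top.mpr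
    (ZMod.castHom_surjective (Dvd.intro_left d hv.symm)), AddSubgroup.card_top, Nat.card_zmod,
    Nat.card_zmod] at hlag
  have hker := Nat.eq_of_mul_eq_mul_right (NeZero.pos t) (hlag.trans hv)
  rw [Nat.card_eq_fintype_card, Fintype.card_subtype] at hker
  refine Eq.trans (congrArg Finset.card ?_) hker
  ext g
  rw [Finset.mem_filter, Finset.mem_filter]
  rfl


/-- Singer model of `PG(2,q)`, `v = q²+q+1 = d·t`, point orbits
`O u = {Pt i | i ≡ u (mod t)}` of `σ^t`, `ℓ0` any fixed line, `w u = |ℓ0 ∩ O u|`.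
Then `Σ_{i<t} w i = q + 1` and `Σ_{i<t} (w i)² = (q² + (t+1)q + 1)/t` (stated
multiplied through by `t`). -/
theorem stmt9
    (p h q v : ℕ) (hp : p.Prime) (hh : 1 ≤ h) (hq : q = p ^ h)
    (hv : v = q ^ 2 + q + 1)
    (F : Type) [Field F] [Fintype F] (hcard : Nat.card F = q ^ 3)
    (Fq : Subfield F) (hcardq : Nat.card Fq = q)
    (α : F) (hα : α ≠ 0) (hprim : ∀ x : F, x ≠ 0 → ∃ i : ℕ, α ^ i = x)
    (Pt : ℕ → Submodule Fq F) (hPt : ∀ i : ℕ, Pt i = Submodule.span Fq {α ^ i})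
    (d t : ℕ) (hd : 0 < d) (hdt : v = d * t)
    (O : ℕ → Set (Submodule Fq F))
    (hO : ∀ u : ℕ, O u = {P : Submodule Fq F | ∃ i : ℕ, i % t = u % t ∧ P = Pt i})
    (ℓ0 : Submodule Fq F) (hline : Module.finrank Fq ℓ0 = 2)
    (w : ℕ → ℕ)
    (hw : ∀ u : ℕ, w u = {P : Submodule Fq F | P ∈ O u ∧ P ≤ ℓ0}.ncard)
    :
    (∑ i ∈ Finset.range t, w i) = q + 1 ∧
    t * (∑ i ∈ Finset.range t, (w i) ^ 2) = q ^ 2 + (t + 1) * q + 1 := by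
  classical
  have hq1 : 1 < q := hq ▸ Nat.one_lt_pow (by omega) hp.one_lt
  have hv0 : NeZero v := ⟨by omega⟩
  have ht0 : NeZero t := ⟨by rintro rfl; omega⟩
  have hord : orderOf α = v * (q - 1) := by
    rw [orderOf_of_forall_exists_pow hα hprim, hcard, hv]
    obtain ⟨r, rfl⟩ := Nat.exists_eq_add_of_lt hq1
    zify [Nat.one_le_pow 3 (1 + r + 1) (by omega), hq1.le]
    ring
  have hcardL : Nat.card ℓ0 = q ^ 2 := by
    rw [Module.natCard_eq_pow_finrank (K := Fq), hcardq, hline]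
  have hαv : α ^ v ∈ Fq := (pow_mem_subfield_iff Fq hq1 hcardq hα hord v).mpr dvd_rfl
  have hper := pow_mem_submodule_periodic Fq hα hαv ℓ0
  set D : Finset (ZMod v) := Finset.univ.filter fun n => α ^ n.val ∈ ℓ0 with hD
  have hmemD (i : ℕ) : (i : ZMod v) ∈ D ↔ α ^ i ∈ ℓ0 := by
    have hp : Function.Periodic (fun i => α ^ i ∈ ℓ0) v := fun i => by
      rw [add_comm]; exact propext (hper i)
    simp only [hD, Finset.mem_filter, Finset.mem_univ, true_and, ZMod.val_natCast]
    exact iff_of_eq (hp.map_mod_nat i)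
  have hcount : Nat.count (fun i => α ^ i ∈ ℓ0) v = D.card := by
    rw [Nat.count_eq_card_filter_range]
    refine Finset.card_nbij (fun i => (i : ZMod v)) ?_ ?_ ?_
    · intro i hi
      exact (hmemD i).mpr (by simpa using (Finset.mem_filter.mp hi).2)
    · intro i hi j hj h
      have hij := (ZMod.natCast_eq_natCast_iff' i j v).mp h
      simp only [Finset.coe_filter, Finset.mem_range, Set.mem_ofPred_eq] at hi hj
      rwa [Nat.mod_eq_of_lt hi.1, Nat.mod_eq_of_lt hj.1] at hij
    · intro n hn
      exact ⟨n.val, by simpa [ZMod.val_lt n] using (Finset.mem_filter.mp hn).2,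
        ZMod.natCast_zmod_val n⟩
  have hDcard : D.card = q + 1 := by
    have h1 := count_pow_mem Fq hα hprim ℓ0
    rw [hord, Nat.count_mul_of_periodic _ hper, hcount, hcardL] at h1
    obtain ⟨r, rfl⟩ := Nat.exists_eq_add_of_lt hq1
    refine Nat.eq_of_mul_eq_mul_left (show 0 < r + 1 by omega) ?_
    rw [show 1 + r + 1 - 1 = r + 1 by omega] at h1
    linarith
  set φ : ZMod v →+ ZMod t :=
    (ZMod.castHom (Dvd.intro_left d hdt.symm) (ZMod t)).toAddMonoidHom with hφ
  have hφcast (i : ℕ) : φ i = i := map_natCast (ZMod.castHom (Dvd.intro_left d hdt.symm) _) i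
  have hwD (u : ℕ) : w u = (D.filter fun n => φ n = (u : ZMod t)).card := by
    rw [hw, ← Set.ncard_coe_finset]
    symm
    refine Set.ncard_congr (fun n _ => Pt n.val) ?_ ?_ ?_
    · intro n hn
      obtain ⟨hnD, hnu⟩ := Finset.mem_filter.mp (Finset.mem_coe.mp hn)
      rw [← ZMod.natCast_zmod_val n, hφcast, ZMod.natCast_eq_natCast_iff'] at hnu
      refine ⟨by rw [hO]; exact ⟨n.val, hnu, rfl⟩, ?_⟩
      rw [hPt, Submodule.span_singleton_le_iff_mem]
      exact (Finset.mem_filter.mp hnD).2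
    · intro m n _ _ h
      rw [hPt, hPt, span_pow_eq_span_pow_iff Fq hq1 hcardq hα hord,
        ← ZMod.natCast_eq_natCast_iff] at h
      simpa using h
    · rintro P ⟨hPO, hPL⟩
      rw [hO] at hPO
      obtain ⟨i, hi, rfl⟩ := hPO
      rw [hPt, Submodule.span_singleton_le_iff_mem] at hPL
      refine ⟨i, ?_, ?_⟩
      · refine Finset.mem_coe.mpr (Finset.mem_filter.mpr ⟨(hmemD i).mpr hPL, ?_⟩)
        rw [hφcast]
        exact (ZMod.natCast_eq_natCast_iff' i u t).mpr hi
      · rw [hPt, hPt, span_pow_eq_span_pow_iff Fq hq1 hcardq hα hord, ZMod.val_natCast]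
        exact Nat.mod_modEq i v
  have hdiff : ∀ k : ZMod v, k ≠ 0 → ∃ m ∈ D, ∃ n ∈ D, m - n = k := by
    intro k _
    obtain ⟨x, hx0, hx, hkx⟩ := exists_ne_zero_mem_mul_mem Fq ℓ0
      (by rw [hcard, hcardL, ← pow_add]; exact Nat.pow_lt_pow_right hq1 (by norm_num)) (α ^ k.val)
    obtain ⟨j, rfl⟩ := hprim x hx0
    rw [← pow_add] at hkx
    exact ⟨_, (hmemD _).mpr hkx, _, (hmemD _).mpr hx, by simp⟩
  have hsq := sum_sq_card_fiber_of_differences φ D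
    (by rw [hDcard, ZMod.card, hv, Nat.add_sub_cancel]; ring) hdiff
  have hker : (Finset.univ.filter fun g : ZMod v => φ g = 0).card = d :=
    ZMod.card_filter_castHom_eq_zero hdt
  simp only [hwD]
  constructor
  · rw [ZMod.sum_range_natCast t fun u => (D.filter fun n => φ n = u).card, ← hDcard]
    exact (Finset.card_eq_sum_card_fiberwise fun _ _ => Finset.mem_coe.mpr (Finset.mem_univ _)).symm
  · rw [ZMod.sum_range_natCast t fun u => (D.filter fun n => φ n = u).card ^ 2]
    rw [hker, hDcard] at hsq
    have hsum : ∑ u : ZMod t, (D.filter fun n => φ n = u).card ^ 2 = q + d := by omega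
    rw [hsum]
    linarith
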